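/- arXiv:2602.21605 — 2 statements merged into one kernel-verified Lean document; each statement's English description precedes it below -/
import Mathlib

section
/- Let φ : A → B be a ring homomorphism such that A and B are f-torsion free for an element f ∈ A, and assume the square with top map φ, bottom map φ_f : A[1/f] → B[1/f], and vertical canonical injections is cartesian (i.e., φ_f^{-1}(B) = A). If A is completely integrally closed in A[1/f], then every element of the image of φ_f that is almost integral over B lies in the image of φ. -/
/-- A ring `A` is `f`-torsion free if the only element killed by a positive power
of `f` is zero. -/
def FTorsionFree {A : Type*} [CommRing A] (f : A) : Prop :=
  ∀ x : A, (∃ n : ℕ, 1 ≤ n ∧ f ^ n * x = 0) → x = 0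

/-- `b : B` is almost integral over `A` (along `φ : A → B`): all powers of `b`
lie in the `A`-span of some finite subset of `B`. -/
def AlmostIntegralElem {A B : Type*} [CommRing A] [CommRing B] (φ : A →+* B)
    (b : B) : Prop :=
  ∃ s : Finset B, ∀ n : ℕ, ∃ c : B → A, b ^ n = ∑ x ∈ s, φ (c x) * x

/-- `A` is completely integrally closed in `B` (along `φ : A → B`). -/
def CompletelyIntegrallyClosedIn {A B : Type*} [CommRing A] [CommRing B]
    (φ : A →+* B) : Prop :=
  ∀ b : B, AlmostIntegralElem φ b → ∃ a : A, φ a = b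

theorem awayMap_algebraMap_apply {A B : Type*} [CommRing A] [CommRing B] (φ : A →+* B) (f a : A) :
    Localization.awayMap φ f (algebraMap A (Localization.Away f) a) =
      algebraMap B (Localization.Away (φ f)) (φ a) := by
  simp [Localization.awayMap, IsLocalization.Away.map]

/-- The powers of an almost integral element of a localization have a common denominator. -/
theorem AlmostIntegralElem.exists_mul_pow_mem_range {B : Type*} [CommRing B] {g : B}
    {y : Localization.Away g}
    (hy : AlmostIntegralElem (algebraMap B (Localization.Away g)) y) :
    ∃ N : ℕ, ∀ n : ℕ, ∃ b : B, algebraMap B (Localization.Away g) b =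
      algebraMap B (Localization.Away g) (g ^ N) * y ^ n := by
  obtain ⟨s, hs⟩ := hy
  obtain ⟨⟨_, N, rfl⟩, hN⟩ :=
    IsLocalization.exist_integer_multiples_of_finset (Submonoid.powers g) s
  refine ⟨N, fun n => ?_⟩
  obtain ⟨c, hc⟩ := hs n
  rw [hc, Finset.mul_sum]
  refine (algebraMap B (Localization.Away g)).range.sum_mem fun z hz => ?_
  obtain ⟨b, hb⟩ := hN z hz
  refine ⟨c z * b, ?_⟩
  rw [map_mul, hb, Algebra.smul_def]
  ring

/-- An element of a localization whose powers have a common denominator is almost integral. -/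
theorem almostIntegralElem_of_mul_pow_mem_range {A : Type*} [CommRing A] {f : A}
    {x : Localization.Away f} (N : ℕ)
    (hx : ∀ n : ℕ, ∃ a : A, algebraMap A (Localization.Away f) a =
      algebraMap A (Localization.Away f) (f ^ N) * x ^ n) :
    AlmostIntegralElem (algebraMap A (Localization.Away f)) x := by
  obtain ⟨u, hu⟩ : IsUnit (algebraMap A (Localization.Away f) (f ^ N)) :=
    IsLocalization.map_units _ (⟨f ^ N, N, rfl⟩ : Submonoid.powers f)
  refine ⟨{(↑u⁻¹ : Localization.Away f)}, fun n => ?_⟩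
  obtain ⟨a, ha⟩ := hx n
  refine ⟨fun _ => a, ?_⟩
  rw [Finset.sum_singleton, ha, ← hu, mul_right_comm, Units.mul_inv, one_mul]

/-- Let `φ : A → B` with `A`, `B` `f`-torsion free, and suppose
the square formed by `φ`, `φ_f : A[1/f] → B[1/f]` and the canonical injections is
cartesian. If `A` is completely integrally closed in `A[1/f]`, then every element
of the image of `φ_f` that is almost integral over `B` lies in the image of `φ`. -/
theorem stmt5 {A B : Type*} [CommRing A] [CommRing B] (φ : A →+* B) (f : A)
    (hA : FTorsionFree f) (hB : FTorsionFree (φ f))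
    -- the square is cartesian: `φ_f⁻¹(B) = A`
    (hcart : ∀ x : Localization.Away f,
      (∃ b : B, algebraMap B (Localization.Away (φ f)) b = Localization.awayMap φ f x) →
      ∃ a : A, algebraMap A (Localization.Away f) a = x)
    -- `A` is completely integrally closed in `A[1/f]`
    (hcic : CompletelyIntegrallyClosedIn (algebraMap A (Localization.Away f))) :
    ∀ y : Localization.Away (φ f),
      (∃ x : Localization.Away f, Localization.awayMap φ f x = y) →
      AlmostIntegralElem (algebraMap B (Localization.Away (φ f))) y →
      ∃ a : A, algebraMap B (Localization.Away (φ f)) (φ a) = y := by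
  rintro _ ⟨x, rfl⟩ hy
  obtain ⟨N, hN⟩ := hy.exists_mul_pow_mem_range
  obtain ⟨a, rfl⟩ := hcic x <| almostIntegralElem_of_mul_pow_mem_range N fun n => by
    obtain ⟨b, hb⟩ := hN n
    exact hcart _ ⟨b, by
      rw [hb, map_mul, awayMap_algebraMap_apply, map_pow φ, map_pow (Localization.awayMap φ f)]⟩
  exact ⟨a, (awayMap_algebraMap_apply φ f a).symm⟩
end

section
/- Let {A_i}_{i∈I} be an inductive (directed) system of commutative rings indexed by a directed set I, with colimit A = colim_{i∈I} A_i. Fix i ∈ I and an element f ∈ A_i. Suppose A_j is f-torsion free for every j ≥ i (hence A is f-torsion free), and suppose that for every j ≥ i the square formed by A_j → A, the localizations A_j[1/f] → A[1/f], and the canonical injections is cartesian. Then the following are equivalent: (1) A_j is completely integrally closed in A_j[1/f] for every j ≥ i; (2) A is completely integrally closed in A[1/f]; (3) the f-adic completion Â of A is completely integrally closed in Â[1/f]. -/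
theorem FTorsionFree.pow_mul_cancel {A : Type*} [CommRing A] {f : A} (hf : FTorsionFree f)
    {n : ℕ} {x y : A} (h : f ^ n * x = f ^ n * y) : x = y := by
  refine sub_eq_zero.mp (hf _ ⟨n + 1, by omega, ?_⟩)
  rw [pow_succ', mul_assoc, mul_sub, h, sub_self, mul_zero]

theorem FTorsionFree.algebraMap_away_injective {A : Type*} [CommRing A] {f : A}
    (hf : FTorsionFree f) :
    Function.Injective (algebraMap A (Localization.Away f)) := by
  intro x y h
  obtain ⟨n, hn⟩ := IsLocalization.Away.exists_of_eq f h
  exact hf.pow_mul_cancel hn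

theorem isUnit_algebraMap_away_pow {A : Type*} [CommRing A] (f : A) (n : ℕ) :
    IsUnit (algebraMap A (Localization.Away f) (f ^ n)) := by
  rw [map_pow]
  exact (IsLocalization.Away.algebraMap_isUnit f).pow n

/-- For an `f`-torsion free ring `A`, complete integral closedness in `A[1/f]` in terms of
divisibility in `A`. -/
theorem completelyIntegrallyClosedIn_away_iff {A : Type*} [CommRing A] {f : A}
    (hf : FTorsionFree f) :
    CompletelyIntegrallyClosedIn (algebraMap A (Localization.Away f)) ↔
      ∀ (x : A) (k m : ℕ), (∀ n, f ^ (k * n) ∣ f ^ m * x ^ n) → f ^ k ∣ x := by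
  constructor
  · intro h x k m hx
    obtain ⟨u, hu⟩ := (isUnit_algebraMap_away_pow f k).exists_right_inv
    obtain ⟨v, hv⟩ := (isUnit_algebraMap_away_pow f m).exists_right_inv
    obtain ⟨a, ha⟩ := h (u * algebraMap A _ x) ⟨{v}, fun n ↦ by
      obtain ⟨y, hy⟩ := hx n
      refine ⟨fun _ ↦ y, ?_⟩
      have hy' := congrArg (algebraMap A (Localization.Away f)) hy
      rw [pow_mul, map_mul, map_mul, map_pow _ x, map_pow _ (f ^ k)] at hy'
      have hun := congrArg (· ^ n) hu
      simp only [mul_pow, one_pow] at hun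
      rw [Finset.sum_singleton, mul_pow]
      linear_combination (-(u ^ n * algebraMap A (Localization.Away f) x ^ n)) * hv
        + u ^ n * v * hy' + algebraMap A (Localization.Away f) y * v * hun⟩
    refine ⟨a, hf.algebraMap_away_injective ?_⟩
    rw [map_mul, ha]
    linear_combination (-algebraMap A (Localization.Away f) x) * hu
  · rintro h b ⟨s, hs⟩
    obtain ⟨k, x, hx⟩ := IsLocalization.Away.surj f b
    obtain ⟨⟨_, m, rfl⟩, hm⟩ :=
      IsLocalization.exist_integer_multiples_of_finset (Submonoid.powers f) s
    rw [← map_pow] at hx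
    have key : f ^ k ∣ x := by
      refine h x k m fun n ↦ ?_
      obtain ⟨c, hc⟩ := hs n
      choose! d hd using hm
      simp only [Algebra.smul_def] at hd
      refine ⟨∑ y ∈ s, c y * d y, hf.algebraMap_away_injective ?_⟩
      have hsum : algebraMap A (Localization.Away f) (f ^ m) * b ^ n =
          algebraMap A _ (∑ y ∈ s, c y * d y) := by
        rw [hc, Finset.mul_sum, map_sum]
        refine Finset.sum_congr rfl fun y hy ↦ ?_
        rw [map_mul, hd y hy]
        ring
      rw [map_mul, map_mul, ← hsum, map_pow _ x, ← hx, pow_mul, map_pow _ (f ^ k)]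
      ring
    obtain ⟨a, rfl⟩ := key
    refine ⟨a, (isUnit_algebraMap_away_pow f k).mul_left_cancel ?_⟩
    rw [← map_mul, ← hx, mul_comm]

/-- Shifting `x` by a multiple of `f ^ k` keeps `x / f ^ k` almost integral. -/
theorem pow_dvd_pow_mul_add_pow {A : Type*} [CommRing A] {f x : A} {k m : ℕ}
    (h : ∀ n, f ^ (k * n) ∣ f ^ m * x ^ n) (z : A) (n : ℕ) :
    f ^ (k * n) ∣ f ^ m * (x + f ^ k * z) ^ n := by
  rw [add_pow, Finset.mul_sum]
  refine Finset.dvd_sum fun j hj ↦ ?_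
  obtain ⟨l, rfl⟩ := Nat.exists_eq_add_of_le (Nat.lt_succ_iff.mp (Finset.mem_range.mp hj))
  obtain ⟨w, hw⟩ := h j
  refine ⟨w * z ^ l * (j + l).choose j, ?_⟩
  rw [Nat.add_sub_cancel_left, mul_add, pow_add, mul_pow, ← pow_mul]
  linear_combination (f ^ (k * l) * z ^ l * (j + l).choose j) * hw

namespace AdicCompletion

variable {A : Type*} [CommRing A] {f : A}

theorem pow_dvd_iff_evalₐ_eq_zero (k : ℕ) (x : AdicCompletion (Ideal.span {f}) A) :
    algebraMap A (AdicCompletion (Ideal.span {f}) A) f ^ k ∣ x ↔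
      evalₐ (Ideal.span {f}) k x = 0 := by
  have hker : evalₐ (Ideal.span {f}) k x = 0 ↔ x ∈ (eval (Ideal.span {f}) A k).ker :=
    EmbeddingLike.map_eq_zero_iff (f := Ideal.quotientEquivAlgOfEq A (Ideal.mul_top _))
  rw [hker, ← pow_smul_top_eq_ker_eval ⟨{f}, by simp⟩, Ideal.span_singleton_pow,
    Submodule.ideal_span_singleton_smul, Submodule.mem_smul_pointwise_iff_exists]
  simp only [Submodule.mem_top, true_and, Algebra.smul_def, map_pow, dvd_def, eq_comm]

theorem evalₐ_algebraMap_eq (k : ℕ) (x : A) :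
    evalₐ (Ideal.span {f}) k (algebraMap A _ x) = Ideal.Quotient.mk _ x :=
  AlgHom.commutes _ x

theorem pow_dvd_algebraMap_iff (k : ℕ) (x : A) :
    algebraMap A (AdicCompletion (Ideal.span {f}) A) f ^ k ∣ algebraMap A _ x ↔ f ^ k ∣ x := by
  rw [pow_dvd_iff_evalₐ_eq_zero, evalₐ_algebraMap_eq, Ideal.Quotient.eq_zero_iff_mem,
    Ideal.span_singleton_pow, Ideal.mem_span_singleton]

theorem exists_eq_algebraMap_add_pow_mul (k : ℕ) (x : AdicCompletion (Ideal.span {f}) A) :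
    ∃ (y : A) (z : AdicCompletion (Ideal.span {f}) A),
      x = algebraMap A _ y + algebraMap A _ f ^ k * z := by
  obtain ⟨y, hy⟩ := Ideal.Quotient.mk_surjective (evalₐ (Ideal.span {f}) k x)
  obtain ⟨z, hz⟩ := (pow_dvd_iff_evalₐ_eq_zero k (x - algebraMap A _ y)).mpr (by
    rw [map_sub, evalₐ_algebraMap_eq, hy, sub_self])
  exact ⟨y, z, by rw [← hz]; ring⟩

theorem fTorsionFree_algebraMap (hf : FTorsionFree f) :
    FTorsionFree (algebraMap A (AdicCompletion (Ideal.span {f}) A) f) := by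
  rintro x ⟨n, -, hx⟩
  refine ext_evalₐ fun k ↦ ?_
  rw [_root_.map_zero, ← pow_dvd_iff_evalₐ_eq_zero]
  obtain ⟨y, z, rfl⟩ := exists_eq_algebraMap_add_pow_mul k x
  refine dvd_add ((pow_dvd_algebraMap_iff k y).mpr ?_) (dvd_mul_right _ _)
  have h : algebraMap A (AdicCompletion (Ideal.span {f}) A) f ^ (n + k) ∣
      algebraMap A _ (f ^ n * y) := by
    refine ⟨-z, ?_⟩
    rw [map_mul, map_pow]
    linear_combination hx
  obtain ⟨w, hw⟩ := (pow_dvd_algebraMap_iff _ _).mp h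
  exact ⟨w, hf.pow_mul_cancel (n := n) (by rw [hw]; ring)⟩

/-- Complete integral closedness in the localization away from `f` is invariant under
`f`-adic completion. -/
theorem completelyIntegrallyClosedIn_away_iff (hf : FTorsionFree f) :
    CompletelyIntegrallyClosedIn (algebraMap A (Localization.Away f)) ↔
      CompletelyIntegrallyClosedIn (algebraMap (AdicCompletion (Ideal.span {f}) A)
        (Localization.Away (algebraMap A (AdicCompletion (Ideal.span {f}) A) f))) := by
  rw [_root_.completelyIntegrallyClosedIn_away_iff hf,
    _root_.completelyIntegrallyClosedIn_away_iff (fTorsionFree_algebraMap hf)]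
  constructor
  · intro h x k m hx
    obtain ⟨y, z, rfl⟩ := exists_eq_algebraMap_add_pow_mul k x
    refine dvd_add ((pow_dvd_algebraMap_iff k y).mpr (h y k m fun n ↦ ?_)) (dvd_mul_right _ _)
    rw [← pow_dvd_algebraMap_iff, map_mul, map_pow, map_pow]
    simpa using pow_dvd_pow_mul_add_pow hx (-z) n
  · intro h x k m hx
    rw [← pow_dvd_algebraMap_iff]
    refine h _ k m fun n ↦ ?_
    rw [← map_pow _ x, ← map_pow _ f m, ← map_mul, pow_dvd_algebraMap_iff]
    exact hx n

end AdicCompletion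

/-- If the square formed by `φ : A → B` and its localization away from `f` is cartesian, then
`φ` reflects divisibility by powers of `f`. -/
theorem pow_dvd_of_pow_dvd_map {A B : Type*} [CommRing A] [CommRing B] {φ : A →+* B} {f : A}
    (hf : FTorsionFree f)
    (hcart : ∀ x : Localization.Away f,
      (∃ b : B, algebraMap B (Localization.Away (φ f)) b = Localization.awayMap φ f x) →
      ∃ y : A, algebraMap A (Localization.Away f) y = x)
    {k : ℕ} {x : A} (h : φ f ^ k ∣ φ x) : f ^ k ∣ x := by
  obtain ⟨b, hb⟩ := h
  obtain ⟨u, hu⟩ := (isUnit_algebraMap_away_pow f k).exists_right_inv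
  have map_eq (a : A) : Localization.awayMap φ f (algebraMap A _ a) = algebraMap B _ (φ a) :=
    IsLocalization.map_eq _ a
  obtain ⟨y, hy⟩ := hcart (u * algebraMap A _ x) ⟨b, by
    have hu' := congrArg (Localization.awayMap φ f) hu
    rw [map_mul, map_one, map_eq, map_pow] at hu'
    rw [map_mul, map_eq, hb, map_mul]
    linear_combination (-algebraMap B (Localization.Away (φ f)) b) * hu'⟩
  refine ⟨y, hf.algebraMap_away_injective ?_⟩
  rw [map_mul, hy]
  linear_combination (-algebraMap A (Localization.Away f) x) * hu

/-- Let `{A_j}` be a directed system of commutative rings with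
colimit `L`, `i` a fixed index and `f ∈ A_i`. Assume each `A_j` (`j ≥ i`) and `L`
are `f`-torsion free, and that for every `j ≥ i` the square formed by `A_j → L`,
the localizations and the canonical injections is cartesian. Then the following
are equivalent: (1) every `A_j` (`j ≥ i`) is completely integrally closed in
`A_j[1/f]`; (2) `L` is completely integrally closed in `L[1/f]`; (3) the `f`-adic
completion of `L` is completely integrally closed in its localization at `f`. -/
theorem stmt8 {ι : Type*} [Preorder ι] [IsDirected ι (· ≤ ·)]
    (A : ι → Type*) [∀ j, CommRing (A j)]
    (t : ∀ j k, j ≤ k → A j →+* A k)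
    (ht_id : ∀ j (x : A j), t j j le_rfl x = x)
    (ht_comp : ∀ j k l (hjk : j ≤ k) (hkl : k ≤ l) (x : A j),
      t k l hkl (t j k hjk x) = t j l (hjk.trans hkl) x)
    -- `L` is the colimit of the system, with structure maps `g j : A j →+* L`
    (L : Type*) [CommRing L] (g : ∀ j, A j →+* L)
    (hg : ∀ j k (hjk : j ≤ k) (x : A j), g k (t j k hjk x) = g j x)
    (hjointsurj : ∀ a : L, ∃ (j : ι) (x : A j), g j x = a)
    (heqfactor : ∀ j (x y : A j), g j x = g j y →
      ∃ (k : ι) (hjk : j ≤ k), t j k hjk x = t j k hjk y)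
    (i : ι) (f : A i)
    -- each `A_j` (`j ≥ i`) is `f`-torsion free (hence so is `L`)
    (htf : ∀ j (hij : i ≤ j), FTorsionFree (t i j hij f))
    (htfL : FTorsionFree (g i f))
    -- each square `A_j → L`, `A_j[1/f] → L[1/f]` is cartesian
    (hcart : ∀ j (hij : i ≤ j), ∀ x : Localization.Away (t i j hij f),
      (∃ a : L, algebraMap L (Localization.Away (g j (t i j hij f))) a =
          Localization.awayMap (g j) (t i j hij f) x) →
      ∃ y : A j, algebraMap (A j) (Localization.Away (t i j hij f)) y = x) :
    -- (1) ↔ (2)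
    ((∀ j (hij : i ≤ j), CompletelyIntegrallyClosedIn
        (algebraMap (A j) (Localization.Away (t i j hij f)))) ↔
      CompletelyIntegrallyClosedIn (algebraMap L (Localization.Away (g i f)))) ∧
    -- (2) ↔ (3)
    (CompletelyIntegrallyClosedIn (algebraMap L (Localization.Away (g i f))) ↔
      CompletelyIntegrallyClosedIn
        (algebraMap (AdicCompletion (Ideal.span {g i f}) L)
          (Localization.Away
            (algebraMap L (AdicCompletion (Ideal.span {g i f}) L) (g i f))))) := by
  have hgf (j) (hij : i ≤ j) : g j (t i j hij f) = g i f := hg i j hij f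
  have hdvd (j) (hij : i ≤ j) (k : ℕ) (x : A j) :
      t i j hij f ^ k ∣ x ↔ g i f ^ k ∣ g j x := by
    refine ⟨fun h ↦ ?_, fun h ↦ pow_dvd_of_pow_dvd_map (htf j hij) (hcart j hij) ?_⟩
    · simpa only [map_pow, hgf] using map_dvd (g j) h
    · rwa [hgf]
  refine ⟨?_, AdicCompletion.completelyIntegrallyClosedIn_away_iff htfL⟩
  rw [completelyIntegrallyClosedIn_away_iff htfL]
  constructor
  · intro h x k m hx
    obtain ⟨j₀, x, rfl⟩ := hjointsurj x
    obtain ⟨j, hij, hj⟩ := exists_ge_ge i j₀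
    rw [← hg j₀ j hj] at hx ⊢
    rw [← hdvd j hij]
    refine (completelyIntegrallyClosedIn_away_iff (htf j hij)).mp (h j hij) _ k m fun n ↦ ?_
    simpa only [hdvd, map_mul, map_pow, hgf] using hx n
  · intro h j hij
    refine (completelyIntegrallyClosedIn_away_iff (htf j hij)).mpr fun x k m hx ↦ ?_
    rw [hdvd]
    refine h _ k m fun n ↦ ?_
    simpa only [hdvd, map_mul, map_pow, hgf] using hx n
end
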